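/- arXiv:2604.08517 — 8 statements merged into one kernel-verified Lean document; each statement's English description precedes it below -/
import Mathlib

section
/- Let 𝒜 be a nonempty set, (Ω, P) a probability space, η > 0, A ∈ ℝ, and let reward : 𝒜 × [0,∞) → ℝ and next : 𝒜 × [0,∞) × Ω → [0,∞) be such that ω ↦ next(a, λ, ω) is measurable for each a ∈ 𝒜 and λ ≥ 0. Let G : [0,∞) → ℝ satisfy G(λ) ≥ 0 for all λ ≥ 0 and suppose ω ↦ G(next(a, λ, ω)) is integrable for each a, λ. Assume that for every λ ≥ 0: sup_{a ∈ 𝒜} [ reward(a, λ) + (1/η)·( ∫_Ω G(next(a, λ, ω)) dP(ω) − G(λ) ) ] ≤ A. Let R : ℕ × [0,∞) → ℝ satisfy R(0, λ) = 0 for all λ ≥ 0 and, for every τ ≥ 1 and λ ≥ 0 (with all the integrands ω ↦ R(τ−1, next(a, λ, ω)) integrable), R(τ, λ) ≤ sup_{a ∈ 𝒜} [ reward(a, λ) + ∫_Ω R(τ−1, next(a, λ, ω)) dP(ω) ]. Then for every τ ∈ ℕ and every λ ≥ 0, R(τ, λ) ≤ A·τ + G(λ)/η. -/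
open MeasureTheory

/-- Separation lemma: if each one-step Lagrangian gain is at most `A` (measured with the
potential `G`), then the recursively defined total reward satisfies
`R τ λ ≤ A·τ + G(λ)/η`. -/
theorem separation_lemma
    {𝒜 : Type*} [Nonempty 𝒜] {Ω : Type*} [MeasurableSpace Ω]
    (P : Measure Ω) [IsProbabilityMeasure P]
    (η A : ℝ) (hη : 0 < η)
    (reward : 𝒜 → ℝ → ℝ) (next : 𝒜 → ℝ → Ω → ℝ)
    (hnext_nonneg : ∀ a : 𝒜, ∀ l : ℝ, 0 ≤ l → ∀ ω : Ω, 0 ≤ next a l ω)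
    (hnext_meas : ∀ a : 𝒜, ∀ l : ℝ, 0 ≤ l → Measurable (fun ω => next a l ω))
    (G : ℝ → ℝ)
    (hG_nonneg : ∀ l : ℝ, 0 ≤ l → 0 ≤ G l)
    (hG_int : ∀ a : 𝒜, ∀ l : ℝ, 0 ≤ l →
      Integrable (fun ω => G (next a l ω)) P)
    -- `sup_a [reward a λ + (1/η)(∫ G(next a λ ω) dP − G λ)] ≤ A` for every λ ≥ 0
    (hA : ∀ l : ℝ, 0 ≤ l → ∀ a : 𝒜,
      reward a l + (1 / η) * ((∫ ω, G (next a l ω) ∂P) - G l) ≤ A)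
    (R : ℕ → ℝ → ℝ)
    (hR0 : ∀ l : ℝ, 0 ≤ l → R 0 l = 0)
    (hR_int : ∀ τ : ℕ, ∀ a : 𝒜, ∀ l : ℝ, 0 ≤ l →
      Integrable (fun ω => R τ (next a l ω)) P)
    -- `R (τ+1) λ ≤ sup_a [reward a λ + ∫ R τ (next a λ ω) dP]`, expressed via ε-approximation
    (hR_rec : ∀ τ : ℕ, ∀ l : ℝ, 0 ≤ l → ∀ ε : ℝ, 0 < ε → ∃ a : 𝒜,
      R (τ + 1) l ≤ reward a l + (∫ ω, R τ (next a l ω) ∂P) + ε) :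
    ∀ τ : ℕ, ∀ l : ℝ, 0 ≤ l → R τ l ≤ A * τ + G l / η := by
  intro τ
  induction τ with
  | zero =>
    intro l hl
    rw [hR0 l hl]
    have := div_nonneg (hG_nonneg l hl) hη.le
    simpa using this
  | succ τ ih =>
    intro l hl
    refine le_of_forall_pos_le_add fun ε hε => ?_
    obtain ⟨a, ha⟩ := hR_rec τ l hl ε hε
    have h1 : (∫ ω, R τ (next a l ω) ∂P) ≤ ∫ ω, (A * τ + G (next a l ω) / η) ∂P :=
      integral_mono (hR_int τ a l hl)
        ((integrable_const _).add ((hG_int a l hl).div_const η))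
        (fun ω => ih _ (hnext_nonneg a l hl ω))
    rw [integral_add (integrable_const _) ((hG_int a l hl).div_const η), integral_div] at h1
    simp only [integral_const, probReal_univ, smul_eq_mul, one_mul] at h1
    have h2 := hA l hl a
    have h3 : (1 / η) * ((∫ ω, G (next a l ω) ∂P) - G l)
        = (∫ ω, G (next a l ω) ∂P) / η - G l / η := by ring
    rw [h3] at h2
    push_cast
    linarith
end

section
/- In the abstract dual setup, assume additionally: (H1) for every b ∈ B and every λ' ≥ 0 with λ'·P_L(b) ≥ ρ_L, one has U(b) − μ·λ'·P_O(b) ≤ R*; and (H2) for every λ ≥ 0, inf_{g ≤ 0} f(λ, g) ≤ R*. Define g*(λ) = sup{ g ∈ ℝ : g ≤ 0 and f(λ, g) ≤ R* } ∈ [−∞, 0], with the convention sup ∅ = −∞. Then g* is weakly increasing on [0,∞): for all 0 ≤ λ₁ ≤ λ₂, g*(λ₁) ≤ g*(λ₂). -/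
/-- Monotonicity of `g*`: under the feasibility hypothesis (H1) and the
strong-duality hypothesis (H2), the extended-real-valued function
`g*(λ) = sup{g ≤ 0 : f(λ, g) ≤ R*}` (with `sup ∅ = −∞`) is weakly increasing on `[0, ∞)`. -/
theorem gstar_monotone
    {B : Type*} [Nonempty B]
    (U PO PL : B → ℝ)
    (hU : ∀ b, U b ≤ 1)
    (hPO : ∀ b, 0 ≤ PO b ∧ PO b ≤ 1)
    (hPL : ∀ b, 0 ≤ PL b ∧ PL b ≤ 1)
    (μ ρL Rstar : ℝ) (hμ : 0 ≤ μ) (hρL : 0 < ρL)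
    (f : ℝ → ℝ → ℝ)
    (hf : ∀ l : ℝ, 0 ≤ l → ∀ g : ℝ,
      f l g = ⨆ b : B, (U b - μ * l * PO b + g * (ρL - l * PL b)))
    -- (H1): every feasible pair (b, λ') has Lagrangian value at most R*
    (H1 : ∀ b : B, ∀ l' : ℝ, 0 ≤ l' → ρL ≤ l' * PL b → U b - μ * l' * PO b ≤ Rstar)
    -- (H2): inf_{g ≤ 0} f(λ, g) ≤ R*, expressed via ε-approximation
    (H2 : ∀ l : ℝ, 0 ≤ l → ∀ ε : ℝ, 0 < ε → ∃ g : ℝ, g ≤ 0 ∧ f l g ≤ Rstar + ε)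
    (gstar : ℝ → EReal)
    (hgstar : ∀ l : ℝ, 0 ≤ l →
      gstar l = sSup {x : EReal | ∃ g : ℝ, x = (g : EReal) ∧ g ≤ 0 ∧ f l g ≤ Rstar}) :
    ∀ l₁ l₂ : ℝ, 0 ≤ l₁ → l₁ ≤ l₂ → gstar l₁ ≤ gstar l₂ := by
  intro l₁ l₂ hl₁ hl
  have hl₂ : 0 ≤ l₂ := hl₁.trans hl
  -- values are bounded by the supremum
  have hle : ∀ l : ℝ, 0 ≤ l → ∀ g : ℝ, ∀ b : B,
      U b - μ * l * PO b + g * (ρL - l * PL b) ≤ f l g := by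
    intro l hl g b
    rw [hf l hl g]
    refine le_ciSup (f := fun b : B => U b - μ * l * PO b + g * (ρL - l * PL b)) ?_ b
    refine ⟨1 + (g * ρL + |g| * l), ?_⟩
    rintro _ ⟨c, rfl⟩
    have h1 : 0 ≤ μ * l * PO c := mul_nonneg (mul_nonneg hμ hl) (hPO c).1
    have h2 : -g * (l * PL c) ≤ |g| * l := by
      have h3 : l * PL c ≤ l := mul_le_of_le_one_right hl (hPL c).2
      have h4 : 0 ≤ l * PL c := mul_nonneg hl (hPL c).1
      calc -g * (l * PL c) ≤ |g| * (l * PL c) :=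
            mul_le_mul_of_nonneg_right (neg_le_abs g) h4
        _ ≤ |g| * l := mul_le_mul_of_nonneg_left h3 (abs_nonneg g)
    have h5 := hU c
    show U c - μ * l * PO c + g * (ρL - l * PL c) ≤ _
    linarith [h1, h2, h5]
  rw [hgstar l₁ hl₁]
  apply sSup_le
  rintro _ ⟨g₁, rfl, hg₁, hfg₁⟩
  -- value at (l₂, g₁) for strategies with positive slope
  have hpos : ∀ b : B, l₂ * PL b < ρL →
      U b - μ * l₂ * PO b + g₁ * (ρL - l₂ * PL b) ≤ Rstar := by
    intro b hb
    have hA := (hle l₁ hl₁ g₁ b).trans hfg₁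
    rcases (hPL b).1.eq_or_lt with h0 | h0
    · rw [← h0] at hA ⊢
      have : μ * l₁ * PO b ≤ μ * l₂ * PO b :=
        mul_le_mul_of_nonneg_right (mul_le_mul_of_nonneg_left hl hμ) (hPO b).1
      linarith
    · have hq : ρL / PL b * PL b = ρL := div_mul_cancel₀ _ h0.ne'
      have hC := H1 b (ρL / PL b) (div_pos hρL h0).le hq.ge
      have hlt : l₂ < ρL / PL b := (lt_div_iff₀ h0).2 hb
      generalize ρL / PL b = q at hq hC hlt
      subst hq
      have e1 := mul_le_mul_of_nonneg_left hA (sub_nonneg.2 hlt.le)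
      have e2 := mul_le_mul_of_nonneg_left hC (sub_nonneg.2 hl)
      have e3 : 0 < q - l₁ := by linarith
      refine le_of_mul_le_mul_left ?_ e3
      linarith
  have key : ∀ n : ℕ, ∃ g : ℝ, g ∈ Set.Icc g₁ 0 ∧ ∀ b : B,
      U b - μ * l₂ * PO b + g * (ρL - l₂ * PL b) ≤ Rstar + 1 / ((n : ℝ) + 1) := by
    intro n
    have hε : (0 : ℝ) < 1 / ((n : ℝ) + 1) := by positivity
    obtain ⟨g, hg, hfg⟩ := H2 l₂ hl₂ _ hε
    rcases le_total g₁ g with h | h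
    · exact ⟨g, ⟨h, hg⟩, fun b => (hle l₂ hl₂ g b).trans hfg⟩
    · refine ⟨g₁, ⟨le_rfl, hg₁⟩, fun b => ?_⟩
      rcases lt_or_ge (l₂ * PL b) ρL with hb | hb
      · linarith [hpos b hb]
      · have h1 := (hle l₂ hl₂ g b).trans hfg
        have h2 := mul_le_mul_of_nonpos_right h (sub_nonpos.2 hb)
        linarith
  choose g hgI hgb using key
  obtain ⟨a, ha, φ, hφ, hlim⟩ := isCompact_Icc.tendsto_subseq hgI
  have hfa : f l₂ a ≤ Rstar := by
    rw [hf l₂ hl₂ a]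
    refine ciSup_le fun b => ?_
    have t1 : Filter.Tendsto
        (fun n => U b - μ * l₂ * PO b + (g ∘ φ) n * (ρL - l₂ * PL b)) Filter.atTop
        (nhds (U b - μ * l₂ * PO b + a * (ρL - l₂ * PL b))) :=
      (hlim.mul_const _).const_add _
    have t2 : Filter.Tendsto (fun n => Rstar + 1 / (((φ n : ℕ) : ℝ) + 1)) Filter.atTop
        (nhds (Rstar + 0)) :=
      ((tendsto_one_div_add_atTop_nhds_zero_nat (𝕜 := ℝ)).comp hφ.tendsto_atTop).const_add _
    rw [add_zero] at t2
    exact le_of_tendsto_of_tendsto' t1 t2 fun n => hgb (φ n) b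
  rw [hgstar l₂ hl₂]
  exact (EReal.coe_le_coe_iff.2 ha.1).trans (le_sSup ⟨a, rfl, ha.2, hfa⟩)
end

section
/- In the abstract dual setup, let λ ≥ 0 and ε ∈ ℝ with λ + ε ≥ 0, and let g ≤ 0. Then f(λ, g) ≤ f(λ + ε, g) + μ·ε⁺ − g·ε⁻, where ε⁺ = max{ε, 0} and ε⁻ = max{−ε, 0}. In particular, if f(λ + ε, g) ≤ R*, then f(λ, g) ≤ R* + μ·ε⁺ − g·ε⁻. -/
/-- Perturbation bound for the dual function: for `λ, λ + ε ≥ 0` and `g ≤ 0`,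
`f(λ, g) ≤ f(λ + ε, g) + μ·ε⁺ − g·ε⁻`; in particular if `f(λ + ε, g) ≤ R*` then
`f(λ, g) ≤ R* + μ·ε⁺ − g·ε⁻`. -/
theorem dual_perturbation_bound
    {B : Type*} [Nonempty B]
    (U PO PL : B → ℝ)
    (hU : ∀ b, U b ≤ 1)
    (hPO : ∀ b, 0 ≤ PO b ∧ PO b ≤ 1)
    (hPL : ∀ b, 0 ≤ PL b ∧ PL b ≤ 1)
    (μ ρL Rstar : ℝ) (hμ : 0 ≤ μ) (hρL : 0 < ρL)
    (f : ℝ → ℝ → ℝ)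
    (hf : ∀ l : ℝ, 0 ≤ l → ∀ g : ℝ,
      f l g = ⨆ b : B, (U b - μ * l * PO b + g * (ρL - l * PL b)))
    (l ε g : ℝ) (hl : 0 ≤ l) (hlε : 0 ≤ l + ε) (hg : g ≤ 0) :
    f l g ≤ f (l + ε) g + μ * max ε 0 - g * max (-ε) 0 ∧
    (f (l + ε) g ≤ Rstar → f l g ≤ Rstar + μ * max ε 0 - g * max (-ε) 0) := by
  have key : f l g ≤ f (l + ε) g + μ * max ε 0 - g * max (-ε) 0 := by
    rw [hf l hl g, hf (l + ε) hlε g]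
    have hbdd : BddAbove (Set.range fun b : B =>
        U b - μ * (l + ε) * PO b + g * (ρL - (l + ε) * PL b)) := by
      refine ⟨1 + g * ρL + (-g) * (l + ε), ?_⟩
      rintro _ ⟨b, rfl⟩
      have h1 : 0 ≤ μ * (l + ε) * PO b := mul_nonneg (mul_nonneg hμ hlε) (hPO b).1
      have h2 : 0 ≤ ((-g) * (l + ε)) * (1 - PL b) :=
        mul_nonneg (mul_nonneg (by linarith) hlε) (by linarith [(hPL b).2])
      have h3 := hU b
      show U b - μ * (l + ε) * PO b + g * (ρL - (l + ε) * PL b) ≤ _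
      nlinarith
    refine ciSup_le fun b => ?_
    have hb := le_ciSup hbdd b
    have hdiff : μ * ε * PO b + g * ε * PL b ≤ μ * max ε 0 - g * max (-ε) 0 := by
      rcases le_total 0 ε with h | h
      · rw [max_eq_left h, max_eq_right (by linarith)]
        have h1 : 0 ≤ (μ * ε) * (1 - PO b) :=
          mul_nonneg (mul_nonneg hμ h) (by linarith [(hPO b).2])
        have h2 : 0 ≤ ((-g) * ε) * PL b :=
          mul_nonneg (mul_nonneg (by linarith) h) (hPL b).1
        linarith
      · rw [max_eq_right h, max_eq_left (by linarith)]
        have h1 : 0 ≤ (μ * (-ε)) * PO b :=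
          mul_nonneg (mul_nonneg hμ (by linarith)) (hPO b).1
        have h2 : 0 ≤ ((-g) * (-ε)) * (1 - PL b) :=
          mul_nonneg (mul_nonneg (by linarith) (by linarith)) (by linarith [(hPL b).2])
        linarith
    linarith
  exact ⟨key, fun h => by linarith⟩
end

section
/- In the abstract dual setup, let σ > 0 and let g : [0,∞) → ℝ be weakly increasing with g(x) ≤ 0 and f(x, g(x)) ≤ R* for every x ≥ 0. Define g_σ(λ) = (1/σ)·∫_λ^{λ+σ} g(x) dx for λ ≥ 0. Then for every λ ≥ 0, f(λ, g_σ(λ)) ≤ R* + μ·σ. -/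
/-- Averaging the dual multiplier over a window of length `σ` costs at most `μσ` in the
dual bound: if `g` is weakly increasing, non-positive, and `f(x, g(x)) ≤ R*` for all
`x ≥ 0`, then `f(λ, g_σ(λ)) ≤ R* + μσ` for all `λ ≥ 0`. -/
theorem averaged_multiplier_dual_bound
    {B : Type*} [Nonempty B]
    (U PO PL : B → ℝ)
    (hU : ∀ b, U b ≤ 1)
    (hPO : ∀ b, 0 ≤ PO b ∧ PO b ≤ 1)
    (hPL : ∀ b, 0 ≤ PL b ∧ PL b ≤ 1)
    (μ ρL Rstar : ℝ) (hμ : 0 ≤ μ) (hρL : 0 < ρL)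
    (f : ℝ → ℝ → ℝ)
    (hf : ∀ l : ℝ, 0 ≤ l → ∀ g : ℝ,
      f l g = ⨆ b : B, (U b - μ * l * PO b + g * (ρL - l * PL b)))
    (σ : ℝ) (hσ : 0 < σ)
    (g : ℝ → ℝ)
    (hg_mono : MonotoneOn g (Set.Ici (0 : ℝ)))
    (hg_nonpos : ∀ x : ℝ, 0 ≤ x → g x ≤ 0)
    (hg_dual : ∀ x : ℝ, 0 ≤ x → f x (g x) ≤ Rstar)
    (gσ : ℝ → ℝ)
    (hgσ : ∀ l : ℝ, 0 ≤ l → gσ l = (1 / σ) * ∫ x in l..(l + σ), g x) :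
    ∀ l : ℝ, 0 ≤ l → f l (gσ l) ≤ Rstar + μ * σ := by
  intro l hl
  rw [hf l hl]
  apply ciSup_le
  intro b
  have hpt : ∀ x ∈ Set.Icc l (l + σ),
      (U b - μ * l * PO b) + g x * (ρL - l * PL b) ≤ Rstar + μ * σ := by
    intro x hx
    have hx0 : 0 ≤ x := hl.trans hx.1
    have hbdd : BddAbove (Set.range
        (fun b : B => U b - μ * x * PO b + g x * (ρL - x * PL b))) := by
      refine ⟨1 - g x * x, ?_⟩
      rintro _ ⟨c, rfl⟩
      have h1 := hU c
      have h2 : 0 ≤ μ * x * PO c := mul_nonneg (mul_nonneg hμ hx0) (hPO c).1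
      have h3 : 0 ≤ (-g x) * ρL := mul_nonneg (by linarith [hg_nonpos x hx0]) hρL.le
      have h4 : 0 ≤ (-g x) * x * (1 - PL c) :=
        mul_nonneg (mul_nonneg (by linarith [hg_nonpos x hx0]) hx0) (by linarith [(hPL c).2])
      show U c - μ * x * PO c + g x * (ρL - x * PL c) ≤ 1 - g x * x
      nlinarith
    have h1 := (le_ciSup hbdd b).trans ((hf x hx0 (g x)).symm.le.trans (hg_dual x hx0))
    have hd : 0 ≤ x - l := by linarith [hx.1]
    have h2 : 0 ≤ (-g x) * (x - l) * PL b :=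
      mul_nonneg (mul_nonneg (by linarith [hg_nonpos x hx0]) hd) (hPL b).1
    have h3 : μ * ((x - l) * PO b) ≤ μ * σ := by
      apply mul_le_mul_of_nonneg_left _ hμ
      have : (x - l) * PO b ≤ (x - l) * 1 := mul_le_mul_of_nonneg_left (hPO b).2 hd
      linarith [hx.2]
    nlinarith
  have hle : l ≤ l + σ := by linarith
  have hint : IntervalIntegrable g MeasureTheory.volume l (l + σ) := by
    apply MonotoneOn.intervalIntegrable
    rw [Set.uIcc_of_le hle]
    exact hg_mono.mono (fun x hx => hl.trans hx.1)
  have hI := intervalIntegral.integral_mono_on hle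
    (intervalIntegrable_const.add (hint.mul_const (ρL - l * PL b)))
    (intervalIntegrable_const (c := Rstar + μ * σ)) hpt
  rw [intervalIntegral.integral_add intervalIntegrable_const (hint.mul_const _),
    intervalIntegral.integral_mul_const, intervalIntegral.integral_const,
    intervalIntegral.integral_const] at hI
  simp only [add_sub_cancel_left, smul_eq_mul] at hI
  rw [hgσ l hl]
  refine le_of_mul_le_mul_left (le_trans (le_of_eq ?_) hI) hσ
  field_simp
end

section
/- Let h : ℝ → ℝ be weakly increasing with h(x) ≤ 0 for all x, let σ > 0, and define h_σ(λ) = (1/σ)·∫_λ^{λ+σ} h(x) dx. Then for every λ ∈ ℝ and every ε ≥ 0: 0 ≤ h_σ(λ + ε) − h_σ(λ) ≤ −(ε/σ)·h(λ). -/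
/-- Lipschitz property of the sliding average: if `h` is weakly increasing and
non-positive, then for all `λ` and `ε ≥ 0`,
`0 ≤ h_σ(λ + ε) − h_σ(λ) ≤ −(ε/σ)·h(λ)`. -/
theorem sliding_average_lipschitz
    (h : ℝ → ℝ) (hmono : Monotone h) (hnonpos : ∀ x : ℝ, h x ≤ 0)
    (σ : ℝ) (hσ : 0 < σ)
    (hσavg : ℝ → ℝ)
    (hdef : ∀ l : ℝ, hσavg l = (1 / σ) * ∫ x in l..(l + σ), h x) :
    ∀ l ε : ℝ, 0 ≤ ε →
      0 ≤ hσavg (l + ε) - hσavg l ∧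
      hσavg (l + ε) - hσavg l ≤ -(ε / σ) * h l := by
  intro l ε hε
  have hi : ∀ a b : ℝ, IntervalIntegrable h MeasureTheory.volume a b :=
    fun a b => hmono.intervalIntegrable
  have e1 := intervalIntegral.integral_add_adjacent_intervals (hi l (l + ε)) (hi (l + ε) (l + ε + σ))
  have e2 := intervalIntegral.integral_add_adjacent_intervals (hi l (l + σ)) (hi (l + σ) (l + ε + σ))
  have e3 : ∫ x in l..(l + ε), h (x + σ) = ∫ x in (l + σ)..(l + ε + σ), h x :=
    intervalIntegral.integral_comp_add_right h σ
  have hs : Monotone fun x => h (x + σ) := fun x y hxy => hmono (by linarith)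
  have e4 : ∫ x in l..(l + ε), h x ≤ ∫ x in l..(l + ε), h (x + σ) :=
    intervalIntegral.integral_mono_on (by linarith) (hi _ _) hs.intervalIntegrable
      (fun x _ => hmono (by linarith))
  have e5 : ∫ x in l..(l + ε), h (x + σ) ≤ ∫ x in l..(l + ε), (0 : ℝ) :=
    intervalIntegral.integral_mono_on (by linarith) hs.intervalIntegrable (by simp)
      (fun x _ => hnonpos _)
  have e6 : ∫ x in l..(l + ε), h l ≤ ∫ x in l..(l + ε), h x :=
    intervalIntegral.integral_mono_on (by linarith) (by simp) (hi _ _)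
      (fun x hx => hmono hx.1)
  simp only [intervalIntegral.integral_const, smul_eq_mul, add_sub_cancel_left, mul_zero] at e5 e6
  have hp : 0 ≤ 1 / σ := by positivity
  rw [hdef, hdef, ← mul_sub]
  refine ⟨mul_nonneg hp (by linarith), ?_⟩
  have : -(ε / σ) * h l = (1 / σ) * (-(ε * h l)) := by ring
  rw [this]
  exact mul_le_mul_of_nonneg_left (by linarith) hp
end

section
/- Let g : [0,∞) → ℝ be weakly increasing with g(x) ≤ 0 for all x ≥ 0, and suppose g(x) = 0 for all x ≥ λ̄ for some λ̄ ≥ 0. Let σ > 0, define g_σ(λ) = (1/σ)·∫_λ^{λ+σ} g(x) dx and G_σ(λ) = −∫_λ^∞ g_σ(x) dx for λ ≥ 0 (a finite integral since g_σ vanishes on [λ̄, ∞)). Then for every λ ≥ 0 and every ε ∈ ℝ with λ + ε ≥ 0: G_σ(λ + ε) − G_σ(λ) ≤ ε·g_σ(λ) − (ε²/σ)·g(λ − ε⁻), where ε⁻ = max{−ε, 0}. -/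
open MeasureTheory

/-- Second-order increment bound for the potential `G_σ(λ) = −∫_λ^∞ g_σ`:
for `λ ≥ 0` and `λ + ε ≥ 0`,
`G_σ(λ+ε) − G_σ(λ) ≤ ε·g_σ(λ) − (ε²/σ)·g(λ − ε⁻)`. -/
theorem potential_increment_bound
    (g : ℝ → ℝ)
    (hg_mono : MonotoneOn g (Set.Ici (0 : ℝ)))
    (hg_nonpos : ∀ x : ℝ, 0 ≤ x → g x ≤ 0)
    (lbar : ℝ) (hlbar : 0 ≤ lbar)
    (hg_zero : ∀ x : ℝ, lbar ≤ x → g x = 0)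
    (σ : ℝ) (hσ : 0 < σ)
    (gσ : ℝ → ℝ)
    (hgσ : ∀ l : ℝ, 0 ≤ l → gσ l = (1 / σ) * ∫ x in l..(l + σ), g x)
    (Gσ : ℝ → ℝ)
    (hGσ : ∀ l : ℝ, 0 ≤ l → Gσ l = -∫ x in Set.Ioi l, gσ x) :
    ∀ l ε : ℝ, 0 ≤ l → 0 ≤ l + ε →
      Gσ (l + ε) - Gσ l ≤ ε * gσ l - (ε ^ 2 / σ) * g (l - max (-ε) 0) := by
  have hint : ∀ a b : ℝ, 0 ≤ a → 0 ≤ b → IntervalIntegrable g volume a b := by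
    intro a b ha hb
    apply MonotoneOn.intervalIntegrable
    apply hg_mono.mono
    intro x hx
    exact le_trans (le_min ha hb) hx.1
  have hmono : MonotoneOn gσ (Set.Ici (0 : ℝ)) := by
    intro a ha b hb hab
    have ha' : (0 : ℝ) ≤ a := ha
    have hb' : (0 : ℝ) ≤ b := hb
    rw [hgσ a ha, hgσ b hb]
    apply mul_le_mul_of_nonneg_left _ (by positivity)
    have e : ∀ c : ℝ, ∫ x in c..(c + σ), g x = ∫ x in (0 : ℝ)..σ, g (c + x) := by
      intro c
      rw [intervalIntegral.integral_comp_add_left (fun x => g x) c, add_zero]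
    have hi : ∀ c : ℝ, 0 ≤ c →
        IntervalIntegrable (fun x => g (c + x)) volume 0 σ := by
      intro c hc
      apply MonotoneOn.intervalIntegrable
      intro x hx y hy hxy
      rw [Set.uIcc_of_le hσ.le] at hx hy
      exact hg_mono (add_nonneg hc hx.1) (add_nonneg hc hy.1) (by linarith)
    rw [e a, e b]
    apply intervalIntegral.integral_mono_on hσ.le (hi a ha') (hi b hb')
    intro x hx
    exact hg_mono (add_nonneg ha' hx.1) (add_nonneg hb' hx.1) (by linarith)
  have hz : ∀ x : ℝ, lbar ≤ x → gσ x = 0 := by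
    intro x hx
    rw [hgσ x (hlbar.trans hx)]
    have : ∫ y in x..(x + σ), g y = ∫ y in x..(x + σ), (0 : ℝ) := by
      apply intervalIntegral.integral_congr
      intro y hy
      rw [Set.uIcc_of_le (by linarith)] at hy
      exact hg_zero y (hx.trans hy.1)
    rw [this]; simp
  have hsint : ∀ a b : ℝ, 0 ≤ a → 0 ≤ b → IntervalIntegrable gσ volume a b := by
    intro a b ha hb
    apply MonotoneOn.intervalIntegrable
    apply hmono.mono
    intro x hx
    exact le_trans (le_min ha hb) hx.1
  have hIoi : ∀ a : ℝ, 0 ≤ a → IntegrableOn gσ (Set.Ioi a) := by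
    intro a ha
    have hM : a ≤ max a lbar := le_max_left _ _
    rw [← Set.Ioc_union_Ioi_eq_Ioi hM]
    apply IntegrableOn.union
    · exact (intervalIntegrable_iff_integrableOn_Ioc_of_le hM).1
        (hsint _ _ ha (ha.trans hM))
    · apply (integrableOn_zero (μ := volume)).congr_fun _ measurableSet_Ioi
      intro x hx
      exact (hz x ((le_max_right a lbar).trans (le_of_lt hx))).symm
  have hG : ∀ a b : ℝ, 0 ≤ a → 0 ≤ b → Gσ b - Gσ a = ∫ x in a..b, gσ x := by
    intro a b ha hb
    rw [hGσ a ha, hGσ b hb,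
      ← intervalIntegral.integral_interval_add_Ioi (hIoi a ha) (hIoi b hb)]
    ring
  have key : ∀ a b : ℝ, 0 ≤ a → a ≤ b → gσ b - gσ a ≤ (b - a) / σ * (-g a) := by
    intro a b ha hab
    have hb := ha.trans hab
    have h1 := intervalIntegral.integral_add_adjacent_intervals
      (hint a b ha hb) (hint b (b + σ) hb (by linarith))
    have h2 := intervalIntegral.integral_add_adjacent_intervals
      (hint a (a + σ) ha (by linarith)) (hint (a + σ) (b + σ) (by linarith) (by linarith))
    have h3 : ∫ x in (a + σ)..(b + σ), g x ≤ 0 := by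
      have := intervalIntegral.integral_mono_on (a := a + σ) (b := b + σ) (by linarith)
        (hint (a + σ) (b + σ) (by linarith) (by linarith))
        (intervalIntegrable_const (c := (0 : ℝ)))
        (fun x hx => hg_nonpos x (by linarith [hx.1]))
      simpa using this
    have h4 : (b - a) * g a ≤ ∫ x in a..b, g x := by
      have := intervalIntegral.integral_mono_on hab
        (intervalIntegrable_const (c := g a)) (hint a b ha hb)
        (fun x hx => hg_mono ha (ha.trans hx.1) hx.1)
      simpa using this
    rw [hgσ a ha, hgσ b hb, ← mul_sub]
    have : (b - a) / σ * (-g a) = 1 / σ * ((b - a) * (-g a)) := by ring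
    rw [this]
    apply mul_le_mul_of_nonneg_left _ (by positivity)
    linarith
  intro l ε hl hle
  rw [hG l (l + ε) hl hle]
  rcases le_total 0 ε with h | h
  · rw [max_eq_right (by linarith), sub_zero]
    have := intervalIntegral.integral_mono_on (a := l) (b := l + ε) (by linarith)
      (hsint l (l + ε) hl hle)
      (intervalIntegrable_const (c := gσ l + ε / σ * (-g l)))
      (fun x hx => by
        have k := key l x hl hx.1
        have : (x - l) / σ * (-g l) ≤ ε / σ * (-g l) := by
          apply mul_le_mul_of_nonneg_right _ (by linarith [hg_nonpos l hl])
          apply div_le_div_of_nonneg_right _ hσ.le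
          linarith [hx.2]
        linarith)
    rw [intervalIntegral.integral_const, smul_eq_mul] at this
    refine this.trans (le_of_eq ?_)
    ring
  · rw [max_eq_left (by linarith), sub_neg_eq_add, intervalIntegral.integral_symm]
    have := intervalIntegral.integral_mono_on (a := l + ε) (b := l) (by linarith)
      (intervalIntegrable_const (c := gσ l - (-ε) / σ * (-g (l + ε))))
      (hsint (l + ε) l hle hl)
      (fun x hx => by
        have hx0 := hle.trans hx.1
        have k := key x l hx0 hx.2
        have : (l - x) / σ * (-g x) ≤ (-ε) / σ * (-g (l + ε)) := by
          apply mul_le_mul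
          · apply div_le_div_of_nonneg_right _ hσ.le
            linarith [hx.1]
          · linarith [hg_mono hle hx0 hx.1]
          · linarith [hg_nonpos x hx0]
          · exact div_nonneg (by linarith) hσ.le
        linarith)
    rw [intervalIntegral.integral_const, smul_eq_mul] at this
    refine (neg_le_neg this).trans (le_of_eq ?_)
    ring
end

section
/- In the abstract dual setup with per-round learner payments, let η ∈ (0,1), σ > 0, and λ̄ ≥ ρ_L. Let g : [0,∞) → ℝ be weakly increasing with g(x) ≤ 0 for all x ≥ 0, g(λ̄) = 0, and f(x, g(x)) ≤ R* for all x ≥ 0. Define g_σ(λ) = (1/σ)·∫_λ^{λ+σ} g(x) dx and G_σ(λ) = −∫_λ^∞ g_σ(x) dx. Then G_σ(λ) ≥ 0 for all λ ≥ 0, and for every λ ≥ 0: sup_{b ∈ B} [ U(b) − μ·λ·P_O(b) + (1/η)·∫_Ω ( G_σ(λ + η·(ρ_L − λ·p_L(b, ω))) − G_σ(λ) ) dP(ω) ] ≤ R* + μ·σ − (η/σ)·( ρ_L² + ((λ̄ − η·ρ_L)/(1 − η))² )·g(0). -/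
open MeasureTheory

/-- The potential `G_σ` verifies the two conditions of the separation lemma with
`A = R* + μσ − (η/σ)(ρ_L² + ((λ̄ − ηρ_L)/(1 − η))²)·g(0)`. -/
theorem potential_verifies_separation_conditions
    {B : Type*} [Nonempty B] {Ω : Type*} [MeasurableSpace Ω]
    (P : Measure Ω) [IsProbabilityMeasure P]
    (U PO : B → ℝ)
    (hU : ∀ b, U b ≤ 1)
    (hPO : ∀ b, 0 ≤ PO b ∧ PO b ≤ 1)
    (pL : B → Ω → ℝ)
    (hpL_bounds : ∀ b ω, 0 ≤ pL b ω ∧ pL b ω ≤ 1)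
    (hpL_meas : ∀ b, Measurable (fun ω => pL b ω))
    (PL : B → ℝ) (hPL : ∀ b, PL b = ∫ ω, pL b ω ∂P)
    (μ ρL Rstar : ℝ) (hμ : 0 ≤ μ) (hρL : 0 < ρL)
    (f : ℝ → ℝ → ℝ)
    (hf : ∀ l : ℝ, 0 ≤ l → ∀ g : ℝ,
      f l g = ⨆ b : B, (U b - μ * l * PO b + g * (ρL - l * PL b)))
    (η σ lbar : ℝ) (hη : 0 < η) (hη1 : η < 1) (hσ : 0 < σ) (hlbar : ρL ≤ lbar)
    (g : ℝ → ℝ)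
    (hg_mono : MonotoneOn g (Set.Ici (0 : ℝ)))
    (hg_nonpos : ∀ x : ℝ, 0 ≤ x → g x ≤ 0)
    (hg_zero : g lbar = 0)
    (hg_dual : ∀ x : ℝ, 0 ≤ x → f x (g x) ≤ Rstar)
    (gσ : ℝ → ℝ)
    (hgσ : ∀ l : ℝ, 0 ≤ l → gσ l = (1 / σ) * ∫ x in l..(l + σ), g x)
    (Gσ : ℝ → ℝ)
    (hGσ : ∀ l : ℝ, 0 ≤ l → Gσ l = -∫ x in Set.Ioi l, gσ x) :
    (∀ l : ℝ, 0 ≤ l → 0 ≤ Gσ l) ∧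
    (∀ l : ℝ, 0 ≤ l → ∀ b : B,
      U b - μ * l * PO b
        + (1 / η) * ∫ ω, (Gσ (l + η * (ρL - l * pL b ω)) - Gσ l) ∂P
      ≤ Rstar + μ * σ
          - (η / σ) * (ρL ^ 2 + ((lbar - η * ρL) / (1 - η)) ^ 2) * g 0) := by
  have hlb0 : 0 ≤ lbar := hρL.le.trans hlbar
  have h1η : 0 < 1 - η := by linarith
  have hg0 : g 0 ≤ 0 := hg_nonpos 0 le_rfl
  have hgge : ∀ x, 0 ≤ x → g 0 ≤ g x := fun x hx => hg_mono (Set.mem_Ici.2 le_rfl) hx hx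
  have hgz : ∀ x, lbar ≤ x → g x = 0 := fun x hx =>
    le_antisymm (hg_nonpos x (hlb0.trans hx)) (hg_zero ▸ hg_mono hlb0 (hlb0.trans hx) hx)
  have hsub : ∀ a b : ℝ, 0 ≤ a → 0 ≤ b → Set.uIcc a b ⊆ Set.Ici (0:ℝ) := by
    intro a b ha hb x hx
    exact (le_min ha hb).trans hx.1
  have hgI : ∀ a b : ℝ, 0 ≤ a → 0 ≤ b → IntervalIntegrable g volume a b := fun a b ha hb =>
    (hg_mono.mono (hsub a b ha hb)).intervalIntegrable
  -- increments of `gσ`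
  have hdiff : ∀ a b : ℝ, 0 ≤ a → a ≤ b →
      gσ b - gσ a = (1 / σ) * ((∫ x in (a+σ)..(b+σ), g x) - ∫ x in a..b, g x) := by
    intro a b ha hab
    have hb := ha.trans hab
    rw [hgσ a ha, hgσ b hb]
    have e1 := intervalIntegral.integral_add_adjacent_intervals
      (hgI a b ha hb) (hgI b (b+σ) hb (by linarith))
    have e2 := intervalIntegral.integral_add_adjacent_intervals
      (hgI a (a+σ) ha (by linarith)) (hgI (a+σ) (b+σ) (by linarith) (by linarith))
    rw [← mul_sub]
    congr 1
    linarith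
  have hmono : ∀ a b : ℝ, 0 ≤ a → a ≤ b → gσ a ≤ gσ b := by
    intro a b ha hab
    have hb := ha.trans hab
    have h := hdiff a b ha hab
    rw [← intervalIntegral.integral_comp_add_right (fun x => g x) σ] at h
    have h2 : (∫ x in a..b, g x) ≤ ∫ x in a..b, g (x + σ) := by
      refine intervalIntegral.integral_mono_on hab (hgI a b ha hb) ?_ ?_
      · have hm : MonotoneOn (fun x => g (x + σ)) (Set.uIcc a b) := by
          intro x hx y hy hxy
          have hx' : 0 ≤ x := hsub a b ha hb hx
          have hy' : 0 ≤ y := hsub a b ha hb hy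
          exact hg_mono (show (0:ℝ) ≤ x + σ by linarith) (show (0:ℝ) ≤ y + σ by linarith)
            (by linarith)
        exact hm.intervalIntegrable
      · intro x hx
        have hx' : 0 ≤ x := ha.trans hx.1
        exact hg_mono hx' (show (0:ℝ) ≤ x + σ by linarith) (by linarith)
    have : 0 ≤ gσ b - gσ a := by
      rw [h]
      exact mul_nonneg (by positivity) (by linarith)
    linarith
  set L : ℝ := -g 0 / σ with hL
  have hL0 : 0 ≤ L := div_nonneg (by linarith) hσ.le
  have hlip : ∀ a b : ℝ, 0 ≤ a → a ≤ b → gσ b - gσ a ≤ L * (b - a) := by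
    intro a b ha hab
    have hb := ha.trans hab
    have h1 : (∫ x in (a+σ)..(b+σ), g x) ≤ ∫ x in (a+σ)..(b+σ), (0:ℝ) := by
      refine intervalIntegral.integral_mono_on (by linarith)
        (hgI _ _ (by linarith) (by linarith)) (by simp) ?_
      intro x hx
      exact hg_nonpos x (by linarith [hx.1])
    have h2 : (∫ x in a..b, g 0) ≤ ∫ x in a..b, g x := by
      refine intervalIntegral.integral_mono_on hab (by simp) (hgI a b ha hb) ?_
      intro x hx
      exact hgge x (ha.trans hx.1)
    simp at h1 h2
    rw [hdiff a b ha hab]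
    have : L * (b - a) = (1 / σ) * (-((b - a) * g 0)) := by rw [hL]; ring
    rw [this]
    exact mul_le_mul_of_nonneg_left (by linarith) (by positivity)
  have hσz : ∀ x, lbar ≤ x → gσ x = 0 := by
    intro x hx
    rw [hgσ x (hlb0.trans hx)]
    have : (∫ y in x..(x+σ), g y) = ∫ y in x..(x+σ), (0:ℝ) := by
      apply intervalIntegral.integral_congr
      intro y hy
      rw [Set.uIcc_of_le (by linarith)] at hy
      exact hgz y (hx.trans hy.1)
    rw [this]; simp
  have hσnp : ∀ x, 0 ≤ x → gσ x ≤ 0 := by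
    intro x hx
    have := hmono x (max x lbar) hx (le_max_left _ _)
    rwa [hσz _ (le_max_right _ _)] at this
  have hσI : ∀ a b : ℝ, 0 ≤ a → 0 ≤ b → IntervalIntegrable gσ volume a b := by
    intro a b ha hb
    have hm : MonotoneOn gσ (Set.uIcc a b) := fun x hx y hy hxy =>
      hmono x y (hsub a b ha hb hx) hxy
    exact hm.intervalIntegrable
  have hσInt0 : IntegrableOn gσ (Set.Ioi 0) := by
    rw [← Set.Ioc_union_Ioi_eq_Ioi hlb0]
    refine IntegrableOn.union ?_ ?_
    · exact (intervalIntegrable_iff_integrableOn_Ioc_of_le hlb0).1 (hσI 0 lbar le_rfl hlb0)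
    · refine (integrableOn_congr_fun (g := fun _ => (0:ℝ)) ?_ measurableSet_Ioi).2 (by simp)
      intro x hx
      exact hσz x (le_of_lt hx)
  have hσInt : ∀ a, 0 ≤ a → IntegrableOn gσ (Set.Ioi a) := fun a ha =>
    hσInt0.mono_set (Set.Ioi_subset_Ioi ha)
  have hGdiff : ∀ a b : ℝ, 0 ≤ a → 0 ≤ b → Gσ b - Gσ a = ∫ x in a..b, gσ x := by
    intro a b ha hb
    have := intervalIntegral.integral_Ioi_sub_Ioi' (hσInt a ha) (hσInt b hb)
    rw [hGσ a ha, hGσ b hb, ← this]; ring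
  have hGnn : ∀ l : ℝ, 0 ≤ l → 0 ≤ Gσ l := by
    intro l hl
    rw [hGσ l hl]
    have : (∫ x in Set.Ioi l, gσ x) ≤ 0 := by
      refine setIntegral_nonpos measurableSet_Ioi ?_
      intro x hx
      exact hσnp x (hl.trans (le_of_lt hx))
    linarith
  have hGanti : ∀ a b : ℝ, 0 ≤ a → a ≤ b → Gσ b ≤ Gσ a := by
    intro a b ha hab
    have h := hGdiff a b ha (ha.trans hab)
    have h1 : (∫ x in a..b, gσ x) ≤ ∫ x in a..b, (0:ℝ) := by
      refine intervalIntegral.integral_mono_on hab (hσI a b ha (ha.trans hab)) (by simp) ?_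
      intro x hx
      exact hσnp x (ha.trans hx.1)
    simp at h1
    linarith
  refine ⟨hGnn, ?_⟩
  have hquad : ∀ a b : ℝ, 0 ≤ a → 0 ≤ b →
      Gσ b - Gσ a ≤ gσ a * (b - a) + L * (b - a) ^ 2 := by
    intro a b ha hb
    rw [hGdiff a b ha hb]
    rcases le_total a b with hab | hab
    · have h1 : (∫ x in a..b, gσ x) ≤ ∫ x in a..b, (gσ a + L * (b - a)) := by
        refine intervalIntegral.integral_mono_on hab (hσI a b ha hb) (by simp) ?_
        intro x hx
        have := hlip a x ha hx.1
        have := mul_le_mul_of_nonneg_left (show x - a ≤ b - a by linarith [hx.2]) hL0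
        linarith
      rw [intervalIntegral.integral_const, smul_eq_mul] at h1
      linarith
    · rw [intervalIntegral.integral_symm]
      have h1 : (∫ x in b..a, (gσ a - L * (a - b))) ≤ ∫ x in b..a, gσ x := by
        refine intervalIntegral.integral_mono_on hab (by simp) (hσI b a hb ha) ?_
        intro x hx
        have := hlip x a (hb.trans hx.1) hx.2
        have := mul_le_mul_of_nonneg_left (show a - x ≤ a - b by linarith [hx.1]) hL0
        linarith
      rw [intervalIntegral.integral_const, smul_eq_mul] at h1
      linarith
  intro l hl b
  set C : ℝ := (lbar - η * ρL) / (1 - η) with hC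
  have hClb : lbar ≤ C := by
    rw [hC, le_div_iff₀ h1η]
    nlinarith
  have hpInt : Integrable (fun ω => pL b ω) P := by
    refine Integrable.of_bound (hpL_meas b).aestronglyMeasurable 1 (Filter.Eventually.of_forall ?_)
    intro ω
    rw [Real.norm_eq_abs, abs_le]
    constructor <;> linarith [(hpL_bounds b ω).1, (hpL_bounds b ω).2]
  have hPL01 : ∀ b, 0 ≤ PL b ∧ PL b ≤ 1 := by
    intro b
    rw [hPL b]
    refine ⟨integral_nonneg fun ω => (hpL_bounds b ω).1, ?_⟩
    have hi : Integrable (fun ω => pL b ω) P := by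
      refine Integrable.of_bound (hpL_meas b).aestronglyMeasurable 1
        (Filter.Eventually.of_forall ?_)
      intro ω
      rw [Real.norm_eq_abs, abs_le]
      constructor <;> linarith [(hpL_bounds b ω).1, (hpL_bounds b ω).2]
    have := integral_mono hi (integrable_const (1:ℝ)) (fun ω => (hpL_bounds b ω).2)
    simpa using this
  -- dual bound
  have hdual : ∀ x, 0 ≤ x → U b - μ * x * PO b + g x * (ρL - x * PL b) ≤ Rstar := by
    intro x hx
    refine le_trans ?_ (hg_dual x hx)
    rw [hf x hx]
    refine le_ciSup (f := fun b : B => U b - μ * x * PO b + g x * (ρL - x * PL b)) ?_ b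
    refine ⟨1 - g x * x, ?_⟩
    rintro _ ⟨c, rfl⟩
    have h1 : 0 ≤ μ * x * PO c := mul_nonneg (mul_nonneg hμ hx) (hPO c).1
    have h2 : g x * ρL ≤ 0 := mul_nonpos_of_nonpos_of_nonneg (hg_nonpos x hx) hρL.le
    have h3 : 0 ≤ (-(g x) * x) * (1 - PL c) :=
      mul_nonneg (mul_nonneg (by linarith [hg_nonpos x hx]) hx) (by linarith [(hPL01 c).2])
    have := hU c
    simp only
    nlinarith
  have hpt : ∀ x, l ≤ x → x ≤ l + σ →
      g x * (ρL - l * PL b) ≤ Rstar + μ * σ - (U b - μ * l * PO b) := by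
    intro x hx hx2
    have h := hdual x (hl.trans hx)
    have h1 : 0 ≤ (-(g x)) * ((x - l) * PL b) :=
      mul_nonneg (by linarith [hg_nonpos x (hl.trans hx)])
        (mul_nonneg (by linarith) (hPL01 b).1)
    have h2 : μ * ((x - l) * PO b) ≤ μ * σ := by
      refine mul_le_mul_of_nonneg_left ?_ hμ
      have := mul_le_mul_of_nonneg_left (hPO b).2 (show 0 ≤ x - l by linarith)
      linarith
    nlinarith
  have hmain : gσ l * (ρL - l * PL b) ≤ Rstar + μ * σ - (U b - μ * l * PO b) := by
    have h1 : (∫ x in l..(l+σ), g x * (ρL - l * PL b)) ≤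
        ∫ x in l..(l+σ), (Rstar + μ * σ - (U b - μ * l * PO b)) := by
      refine intervalIntegral.integral_mono_on (by linarith)
        ((hgI l (l+σ) hl (by linarith)).mul_const _) (by simp) ?_
      intro x hx
      exact hpt x hx.1 hx.2
    rw [intervalIntegral.integral_const, smul_eq_mul, intervalIntegral.integral_mul_const] at h1
    have h2 := mul_le_mul_of_nonneg_left h1 (show 0 ≤ 1 / σ by positivity)
    rw [hgσ l hl]
    have h3 : 1 / σ * ((l + σ - l) * (Rstar + μ * σ - (U b - μ * l * PO b))) =
        Rstar + μ * σ - (U b - μ * l * PO b) := by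
      field_simp
      ring
    rw [h3] at h2
    linarith
  have harg : ∀ ω, 0 ≤ l + η * (ρL - l * pL b ω) := by
    intro ω
    have h1 : l * pL b ω ≤ l := by
      have := mul_le_mul_of_nonneg_left (hpL_bounds b ω).2 hl
      linarith
    have h2 : η * (l * pL b ω) ≤ 1 * l :=
      mul_le_mul hη1.le h1 (mul_nonneg hl (hpL_bounds b ω).1) zero_le_one
    have := mul_pos hη hρL
    linarith
  have hstep : ∀ ω, Gσ (l + η * (ρL - l * pL b ω)) - Gσ l ≤
      η * (gσ l * (ρL - l * pL b ω) + η * L * (ρL ^ 2 + C ^ 2)) := by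
    intro ω
    have hp := hpL_bounds b ω
    have hlp0 : 0 ≤ l * pL b ω := mul_nonneg hl hp.1
    have hlp1 : l * pL b ω ≤ l := by
      have := mul_le_mul_of_nonneg_left hp.2 hl
      linarith
    rcases le_or_gt l C with hlC | hlC
    · have h := hquad l _ hl (harg ω)
      have hd : (ρL - l * pL b ω) ^ 2 ≤ ρL ^ 2 + C ^ 2 := by nlinarith
      have := mul_le_mul_of_nonneg_left hd (show 0 ≤ η * η * L by positivity)
      nlinarith
    · have hll : lbar ≤ l := by linarith
      have hlow : lbar ≤ l + η * (ρL - l * pL b ω) := by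
        have h1 : lbar - η * ρL < l * (1 - η) := by
          rwa [hC, div_lt_iff₀ h1η] at hlC
        have := mul_le_mul_of_nonneg_left hlp1 hη.le
        linarith
      have hz : Gσ (l + η * (ρL - l * pL b ω)) - Gσ l = 0 := by
        rw [hGdiff l _ hl (harg ω)]
        have : (∫ y in l..(l + η * (ρL - l * pL b ω)), gσ y) =
            ∫ y in l..(l + η * (ρL - l * pL b ω)), (0:ℝ) := by
          apply intervalIntegral.integral_congr
          intro y hy
          exact hσz y ((le_min hll hlow).trans hy.1)
        rw [this]; simp
      rw [hz, hσz l hll]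
      have : 0 ≤ η * (η * L * (ρL ^ 2 + C ^ 2)) := by positivity
      linarith
  have hIntL : Integrable (fun ω => Gσ (l + η * (ρL - l * pL b ω)) - Gσ l) P := by
    refine Integrable.sub ?_ (integrable_const _)
    have hanti : Antitone (fun x : ℝ => Gσ (max x 0)) := fun x y hxy =>
      hGanti _ _ (le_max_right _ _) (max_le_max_right 0 hxy)
    have hmeas : Measurable (fun ω => l + η * (ρL - l * pL b ω)) := by
      have := hpL_meas b
      fun_prop
    have hm2 : Measurable (fun ω => Gσ (l + η * (ρL - l * pL b ω))) := by
      have h := hanti.measurable.comp hmeas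
      have e : (fun x : ℝ => Gσ (max x 0)) ∘ (fun ω => l + η * (ρL - l * pL b ω)) =
          fun ω => Gσ (l + η * (ρL - l * pL b ω)) := by
        funext ω
        simp only [Function.comp, max_eq_left (harg ω)]
      rwa [e] at h
    refine Integrable.of_bound hm2.aestronglyMeasurable (Gσ 0) (Filter.Eventually.of_forall ?_)
    intro ω
    rw [Real.norm_eq_abs, abs_of_nonneg (hGnn _ (harg ω))]
    exact hGanti 0 _ le_rfl (harg ω)
  have hIntR : Integrable (fun ω =>
      η * (gσ l * (ρL - l * pL b ω) + η * L * (ρL ^ 2 + C ^ 2))) P := by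
    fun_prop
  have hI := integral_mono hIntL hIntR hstep
  have hval : (∫ ω, η * (gσ l * (ρL - l * pL b ω) + η * L * (ρL ^ 2 + C ^ 2)) ∂P) =
      η * (gσ l * (ρL - l * PL b) + η * L * (ρL ^ 2 + C ^ 2)) := by
    rw [integral_const_mul, integral_add (by fun_prop) (by fun_prop), integral_const_mul,
      integral_sub (by fun_prop) (by fun_prop), integral_const_mul, ← hPL b]
    simp
  have hI2 : (∫ ω, (Gσ (l + η * (ρL - l * pL b ω)) - Gσ l) ∂P) ≤
      η * (gσ l * (ρL - l * PL b) + η * L * (ρL ^ 2 + C ^ 2)) := hI.trans_eq hval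
  have hI3 := mul_le_mul_of_nonneg_left hI2 (show 0 ≤ 1 / η by positivity)
  have h4 : 1 / η * (η * (gσ l * (ρL - l * PL b) + η * L * (ρL ^ 2 + C ^ 2))) =
      gσ l * (ρL - l * PL b) - (η / σ) * (ρL ^ 2 + C ^ 2) * g 0 := by
    rw [hL]; field_simp; ring
  rw [h4] at hI3
  linarith
end

section
/- In the abstract dual setup with per-round learner payments, let η ∈ (0,1), σ > 0, and λ̄ ≥ ρ_L. Let g : [0,∞) → ℝ be weakly increasing with g(x) ≤ 0 for all x ≥ 0, g(λ̄) = 0, and f(x, g(x)) ≤ R* for all x ≥ 0. Let R : ℕ × [0,∞) → ℝ satisfy R(0, λ) = 0 for all λ ≥ 0 and, for every τ ≥ 1 and λ ≥ 0 (with all integrands ω ↦ R(τ−1, λ + η(ρ_L − λ·p_L(b, ω))) integrable), R(τ, λ) ≤ sup_{b ∈ B} [ U(b) − μ·λ·P_O(b) + ∫_Ω R(τ−1, λ + η·(ρ_L − λ·p_L(b, ω))) dP(ω) ]. Then for every T ∈ ℕ: R(T, 0) ≤ T·( R* + μ·σ − (η/σ)·( ρ_L² + ((λ̄ − η·ρ_L)/(1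 − η))² )·g(0) ) − λ̄·g(0)/η. -/
open MeasureTheory

/-- A smoothed version of a monotone function: average on `[x, x+σ]`, with its basic facts. -/
lemma smooth_aux (h : ℝ → ℝ) (hm : Monotone h) (hn : ∀ x, h x ≤ 0) (c : ℝ) (hc : ∀ x, c ≤ h x)
    (σ : ℝ) (hσ : 0 < σ) :
    ∃ G : ℝ → ℝ, (∀ x, σ * G x = ∫ t in x..(x + σ), h t) ∧ Monotone G ∧ (∀ x, c ≤ G x) ∧
      (∀ x, h x ≤ G x) ∧ (∀ x, G x ≤ 0) ∧ (∀ x y, x ≤ y → G y - G x ≤ (-c / σ) * (y - x)) := by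
  have hi : ∀ a b, IntervalIntegrable h volume a b := fun a b => hm.intervalIntegrable
  have key : ∀ x, σ * ((1 / σ) * ∫ t in x..(x + σ), h t) = ∫ t in x..(x + σ), h t := by
    intro x; field_simp
  have hlow : ∀ x, h x ≤ (1 / σ) * ∫ t in x..(x + σ), h t := by
    intro x
    have : ∫ t in x..(x + σ), h x ≤ ∫ t in x..(x + σ), h t :=
      intervalIntegral.integral_mono_on (by linarith) (by simp) (hi _ _)
        (fun t ht => hm ht.1)
    simp only [intervalIntegral.integral_const, smul_eq_mul, add_sub_cancel_left] at this
    rw [← key x] at this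
    exact le_of_mul_le_mul_left this hσ
  refine ⟨fun x => (1 / σ) * ∫ t in x..(x + σ), h t, key, ?_, fun x => (hc x).trans (hlow x),
    hlow, ?_, ?_⟩
  · intro x y hxy
    have e : ∀ z, ∫ t in z..(z + σ), h t = ∫ t in (0:ℝ)..σ, h (t + z) := by
      intro z
      rw [intervalIntegral.integral_comp_add_right]
      simp [add_comm]
    simp only [e]
    apply mul_le_mul_of_nonneg_left _ (by positivity)
    apply intervalIntegral.integral_mono_on hσ.le
    · exact Monotone.intervalIntegrable (fun a b hab => hm (by linarith))
    · exact Monotone.intervalIntegrable (fun a b hab => hm (by linarith))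
    · intro t _; exact hm (by linarith)
  · intro x
    have : ∫ t in x..(x + σ), h t ≤ ∫ t in x..(x + σ), (0:ℝ) :=
      intervalIntegral.integral_mono_on (by linarith) (hi _ _) (by simp) (fun t _ => hn t)
    simp only [intervalIntegral.integral_zero] at this
    exact mul_nonpos_of_nonneg_of_nonpos (by positivity) this
  · intro x y hxy
    have e1 : (∫ t in x..(x + σ), h t) + ∫ t in (x + σ)..(y + σ), h t
        = ∫ t in x..(y + σ), h t :=
      intervalIntegral.integral_add_adjacent_intervals (hi _ _) (hi _ _)
    have e2 : (∫ t in x..y, h t) + ∫ t in y..(y + σ), h t = ∫ t in x..(y + σ), h t :=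
      intervalIntegral.integral_add_adjacent_intervals (hi _ _) (hi _ _)
    have a1 : ∫ t in (x + σ)..(y + σ), h t ≤ ∫ t in (x + σ)..(y + σ), (0:ℝ) :=
      intervalIntegral.integral_mono_on (by linarith) (hi _ _) (by simp) (fun t _ => hn t)
    have a2 : ∫ t in x..y, c ≤ ∫ t in x..y, h t :=
      intervalIntegral.integral_mono_on (by linarith) (by simp) (hi _ _) (fun t _ => hc t)
    simp only [intervalIntegral.integral_const, smul_eq_mul, intervalIntegral.integral_zero]
      at a1 a2
    have : (∫ t in y..(y + σ), h t) - (∫ t in x..(x + σ), h t) ≤ (y - x) * (-c) := by linarith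
    calc _ = (1 / σ) * ((∫ t in y..(y + σ), h t) - (∫ t in x..(x + σ), h t)) := by ring
      _ ≤ (1 / σ) * ((y - x) * (-c)) := mul_le_mul_of_nonneg_left this (by positivity)
      _ = _ := by ring

/-- The antiderivative of a monotone Lipschitz function has a quadratic upper bound. -/
lemma quad_aux (G : ℝ → ℝ) (hm : Monotone G) (L : ℝ)
    (hL : ∀ x y, x ≤ y → G y - G x ≤ L * (y - x)) (hL0 : 0 ≤ L) (x y : ℝ) :
    ∫ t in x..y, G t ≤ G x * (y - x) + L * (y - x) ^ 2 := by
  rcases le_total x y with hxy | hxy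
  · have : ∫ t in x..y, G t ≤ ∫ t in x..y, (G x + L * (y - x)) := by
      apply intervalIntegral.integral_mono_on hxy hm.intervalIntegrable (by simp)
      intro t ht
      have := hL x t ht.1
      have : L * (t - x) ≤ L * (y - x) := mul_le_mul_of_nonneg_left (by linarith [ht.2]) hL0
      linarith
    simp only [intervalIntegral.integral_const, smul_eq_mul] at this
    linarith
  · have : ∫ t in y..x, (G x - L * (x - y)) ≤ ∫ t in y..x, G t := by
      apply intervalIntegral.integral_mono_on hxy (by simp) hm.intervalIntegrable
      intro t ht
      have := hL t x ht.2
      have : L * (x - t) ≤ L * (x - y) := mul_le_mul_of_nonneg_left (by linarith [ht.1]) hL0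
      linarith
    simp only [intervalIntegral.integral_const, smul_eq_mul] at this
    rw [intervalIntegral.integral_symm]
    linarith

/-- Quantitative bound on the optimizer's total Lagrangian reward: under the dual setup
with per-round learner payments and a well-behaved dual multiplier `g`, the recursively
defined reward satisfies
`R(T, 0) ≤ T·(R* + μσ − (η/σ)(ρ_L² + ((λ̄ − ηρ_L)/(1 − η))²)·g(0)) − λ̄·g(0)/η`. -/
theorem total_reward_bound
    {B : Type*} [Nonempty B] {Ω : Type*} [MeasurableSpace Ω]
    (P : Measure Ω) [IsProbabilityMeasure P]
    (U PO : B → ℝ)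
    (hU : ∀ b, U b ≤ 1)
    (hPO : ∀ b, 0 ≤ PO b ∧ PO b ≤ 1)
    (pL : B → Ω → ℝ)
    (hpL_bounds : ∀ b ω, 0 ≤ pL b ω ∧ pL b ω ≤ 1)
    (hpL_meas : ∀ b, Measurable (fun ω => pL b ω))
    (PL : B → ℝ) (hPL : ∀ b, PL b = ∫ ω, pL b ω ∂P)
    (μ ρL Rstar : ℝ) (hμ : 0 ≤ μ) (hρL : 0 < ρL)
    (f : ℝ → ℝ → ℝ)
    (hf : ∀ l : ℝ, 0 ≤ l → ∀ g : ℝ,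
      f l g = ⨆ b : B, (U b - μ * l * PO b + g * (ρL - l * PL b)))
    (η σ lbar : ℝ) (hη : 0 < η) (hη1 : η < 1) (hσ : 0 < σ) (hlbar : ρL ≤ lbar)
    (g : ℝ → ℝ)
    (hg_mono : MonotoneOn g (Set.Ici (0 : ℝ)))
    (hg_nonpos : ∀ x : ℝ, 0 ≤ x → g x ≤ 0)
    (hg_zero : g lbar = 0)
    (hg_dual : ∀ x : ℝ, 0 ≤ x → f x (g x) ≤ Rstar)
    (R : ℕ → ℝ → ℝ)
    (hR0 : ∀ l : ℝ, 0 ≤ l → R 0 l = 0)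
    (hR_int : ∀ τ : ℕ, ∀ b : B, ∀ l : ℝ, 0 ≤ l →
      Integrable (fun ω => R τ (l + η * (ρL - l * pL b ω))) P)
    -- `R (τ+1) λ ≤ sup_b [U(b) − μλP_O(b) + ∫ R τ (λ + η(ρ_L − λ p_L(b,ω))) dP]`,
    -- expressed via ε-approximation
    (hR_rec : ∀ τ : ℕ, ∀ l : ℝ, 0 ≤ l → ∀ ε : ℝ, 0 < ε → ∃ b : B,
      R (τ + 1) l ≤ U b - μ * l * PO b
        + (∫ ω, R τ (l + η * (ρL - l * pL b ω)) ∂P) + ε) :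
    ∀ T : ℕ,
      R T 0 ≤ (T : ℝ) * (Rstar + μ * σ
          - (η / σ) * (ρL ^ 2 + ((lbar - η * ρL) / (1 - η)) ^ 2) * g 0)
        - lbar * g 0 / η := by
  have hlb0 : 0 < lbar := lt_of_lt_of_le hρL hlbar
  have hpi : ∀ b, Integrable (fun ω => pL b ω) P := fun b =>
    Integrable.of_bound (hpL_meas b).aestronglyMeasurable 1
      (Filter.Eventually.of_forall fun ω => by
        rw [Real.norm_eq_abs, abs_of_nonneg (hpL_bounds b ω).1]; exact (hpL_bounds b ω).2)
  have hPL0 : ∀ b, 0 ≤ PL b := fun b => by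
    rw [hPL]; exact integral_nonneg fun ω => (hpL_bounds b ω).1
  have hPL1 : ∀ b, PL b ≤ 1 := fun b => by
    rw [hPL]
    have : ∫ ω, pL b ω ∂P ≤ ∫ ω, (1:ℝ) ∂P :=
      integral_mono (hpi b) (integrable_const _) (fun ω => (hpL_bounds b ω).2)
    simpa using this
  -- pointwise dual bound
  have hdual : ∀ x, 0 ≤ x → ∀ b, U b - μ * x * PO b + g x * (ρL - x * PL b) ≤ Rstar := by
    intro x hx b
    refine le_trans ?_ (hg_dual x hx)
    rw [hf x hx]
    refine le_ciSup (f := fun b => U b - μ * x * PO b + g x * (ρL - x * PL b)) ?_ b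
    refine ⟨1 + (-g x) * x, ?_⟩
    rintro _ ⟨b, rfl⟩
    have h1 := hU b
    have h2 : 0 ≤ μ * x * PO b := mul_nonneg (mul_nonneg hμ hx) (hPO b).1
    have hgx := hg_nonpos x hx
    have h3 : 0 ≤ (-g x) * ρL := mul_nonneg (by linarith) hρL.le
    have h4 : (-g x) * x * PL b ≤ (-g x) * x * 1 :=
      mul_le_mul_of_nonneg_left (hPL1 b) (mul_nonneg (by linarith) hx)
    simp only
    nlinarith
  have hg0 : g 0 ≤ 0 := hg_nonpos 0 le_rfl
  have hgbar : ∀ x, lbar ≤ x → g x = 0 := fun x hx =>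
    le_antisymm (hg_nonpos x (by linarith))
      (hg_zero ▸ hg_mono (Set.mem_Ici.2 hlb0.le) (Set.mem_Ici.2 (by linarith)) hx)
  obtain ⟨G, hGint, hGm, hGc, hGh, hG0, hGL⟩ := smooth_aux (fun x => g (max x 0))
    (fun x y hxy => hg_mono (Set.mem_Ici.2 (le_max_right _ _)) (Set.mem_Ici.2 (le_max_right _ _))
      (max_le_max_right _ hxy))
    (fun x => hg_nonpos _ (le_max_right _ _)) (g 0)
    (fun x => hg_mono (Set.mem_Ici.2 le_rfl) (Set.mem_Ici.2 (le_max_right _ _))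
      (le_max_right _ _)) σ hσ
  have hhi : ∀ a b, IntervalIntegrable (fun x => g (max x 0)) volume a b := fun a b =>
    Monotone.intervalIntegrable (fun x y hxy => hg_mono (Set.mem_Ici.2 (le_max_right _ _))
      (Set.mem_Ici.2 (le_max_right _ _)) (max_le_max_right _ hxy))
  have hGbar : ∀ x, lbar ≤ x → G x = 0 := fun x hx => by
    refine le_antisymm (hG0 x) ?_
    have := hGh x
    rwa [hgbar _ (hx.trans (le_max_left _ _))] at this
  -- smoothed dual bound
  have hGdual : ∀ x, 0 ≤ x → ∀ b,
      U b - μ * x * PO b + G x * (ρL - x * PL b) ≤ Rstar + μ * σ := by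
    intro x hx b
    have : ∫ t in x..(x + σ), g (max t 0) * (ρL - x * PL b)
        ≤ ∫ t in x..(x + σ), (Rstar - U b + μ * x * PO b + μ * σ) := by
      apply intervalIntegral.integral_mono_on (by linarith) ((hhi _ _).mul_const _) (by simp)
      intro t ht
      have ht0 : 0 ≤ t := hx.trans ht.1
      rw [max_eq_left ht0]
      have h1 := hdual t ht0 b
      have h2 : 0 ≤ (-g t) * ((t - x) * PL b) :=
        mul_nonneg (by linarith [hg_nonpos t ht0]) (mul_nonneg (by linarith [ht.1]) (hPL0 b))
      have h3 : (t - x) * PO b ≤ σ * 1 :=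
        mul_le_mul (by linarith [ht.2]) (hPO b).2 (hPO b).1 hσ.le
      have h4 := mul_le_mul_of_nonneg_left h3 hμ
      linarith
    rw [intervalIntegral.integral_mul_const, ← hGint] at this
    simp only [intervalIntegral.integral_const, smul_eq_mul, add_sub_cancel_left] at this
    rw [mul_assoc] at this
    have := le_of_mul_le_mul_left this hσ
    linarith
  have hGi : ∀ a b, IntervalIntegrable G volume a b := fun a b => hGm.intervalIntegrable
  have hL0 : 0 ≤ -g 0 / σ := div_nonneg (by linarith) hσ.le
  obtain ⟨V, hV⟩ : ∃ V : ℝ → ℝ, ∀ x, V x = (1 / η) * ∫ t in lbar..x, G t := ⟨_, fun _ => rfl⟩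
  have hVdiff : ∀ x y, V y ≤ V x + (1 / η) * (G x * (y - x) + (-g 0 / σ) * (y - x) ^ 2) := by
    intro x y
    have e : (∫ t in lbar..x, G t) + ∫ t in x..y, G t = ∫ t in lbar..y, G t :=
      intervalIntegral.integral_add_adjacent_intervals (hGi _ _) (hGi _ _)
    rw [hV, hV, ← e, mul_add]
    have := mul_le_mul_of_nonneg_left (quad_aux G hGm _ hGL hL0 x y)
      (show 0 ≤ 1 / η by positivity)
    linarith
  have hVbar : ∀ x, lbar ≤ x → V x = 0 := by
    intro x hx
    rw [hV, intervalIntegral.integral_congr (g := fun _ => (0:ℝ))]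
    · simp
    · intro t ht
      rw [Set.uIcc_of_le hx] at ht
      exact hGbar t ht.1
  have hVnn : ∀ x, 0 ≤ V x := by
    intro x
    rcases le_total lbar x with hx | hx
    · rw [hVbar x hx]
    · rw [hV, intervalIntegral.integral_symm]
      have : ∫ t in x..lbar, G t ≤ ∫ t in x..lbar, (0:ℝ) :=
        intervalIntegral.integral_mono_on hx (hGi _ _) (by simp) (fun t _ => hG0 t)
      simp only [intervalIntegral.integral_zero] at this
      exact mul_nonneg (by positivity) (by linarith)
  have hV0 : V 0 ≤ - lbar * g 0 / η := by
    rw [hV, intervalIntegral.integral_symm]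
    have : ∫ t in (0:ℝ)..lbar, g 0 ≤ ∫ t in (0:ℝ)..lbar, G t :=
      intervalIntegral.integral_mono_on hlb0.le (by simp) (hGi _ _) (fun t _ => hGc t)
    simp only [intervalIntegral.integral_const, smul_eq_mul] at this
    calc _ ≤ (1 / η) * (-((lbar - 0) * g 0)) :=
          mul_le_mul_of_nonneg_left (by linarith) (by positivity)
      _ = _ := by ring
  obtain ⟨K, hK⟩ : ∃ K, K = ρL ^ 2 + ((lbar - η * ρL) / (1 - η)) ^ 2 := ⟨_, rfl⟩
  rw [← hK]
  have hKnn : 0 ≤ K := by rw [hK]; positivity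
  have h1η : 0 < 1 - η := by linarith
  -- one-step potential bound
  have hstep : ∀ l, 0 ≤ l → ∀ b ω, V (l + η * (ρL - l * pL b ω)) ≤
      V l + G l * (ρL - l * pL b ω) + (η * (-g 0 / σ)) * K := by
    intro l hl b ω
    obtain ⟨p0, p1⟩ := hpL_bounds b ω
    have hlp : l * pL b ω ≤ l := by nlinarith
    have hlp0 : 0 ≤ l * pL b ω := mul_nonneg hl p0
    have hLK : 0 ≤ (η * (-g 0 / σ)) * K := mul_nonneg (mul_nonneg hη.le hL0) hKnn
    rcases le_total ((lbar - η * ρL) / (1 - η)) l with hc | hc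
    · have hc' := (div_le_iff₀ h1η).1 hc
      have hll : lbar ≤ l := by
        by_contra hcon
        push Not at hcon
        nlinarith
      have : lbar ≤ l + η * (ρL - l * pL b ω) := by nlinarith
      rw [hVbar _ this, hVbar _ hll, hGbar _ hll]
      linarith
    · have hsq : (ρL - l * pL b ω) ^ 2 ≤ K := by
        have : (l * pL b ω) ^ 2 ≤ ((lbar - η * ρL) / (1 - η)) ^ 2 :=
          pow_le_pow_left₀ hlp0 (hlp.trans hc) 2
        rw [hK]
        nlinarith [mul_nonneg hρL.le hlp0]
      have h := hVdiff l (l + η * (ρL - l * pL b ω))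
      have e : (1 / η) * (G l * (l + η * (ρL - l * pL b ω) - l)
          + (-g 0 / σ) * (l + η * (ρL - l * pL b ω) - l) ^ 2)
          = G l * (ρL - l * pL b ω) + (η * (-g 0 / σ)) * (ρL - l * pL b ω) ^ 2 := by
        field_simp
        ring
      rw [e] at h
      have := mul_le_mul_of_nonneg_left hsq (mul_nonneg hη.le hL0)
      linarith
  obtain ⟨C, hC⟩ : ∃ C, C = Rstar + μ * σ - (η / σ) * K * g 0 := ⟨_, rfl⟩
  rw [← hC]
  have hC' : C = Rstar + μ * σ + (η * (-g 0 / σ)) * K := by rw [hC]; ring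
  have main : ∀ τ : ℕ, ∀ l, 0 ≤ l → R τ l ≤ τ * C + V l := by
    intro τ
    induction τ with
    | zero => intro l hl; rw [hR0 l hl]; simpa using hVnn l
    | succ τ ih =>
      intro l hl
      refine le_of_forall_pos_le_add fun ε hε => ?_
      obtain ⟨b, hb⟩ := hR_rec τ l hl ε hε
      have hpt : ∀ ω, R τ (l + η * (ρL - l * pL b ω)) ≤
          (τ * C + V l + G l * ρL + (η * (-g 0 / σ)) * K) - (G l * l) * pL b ω := by
        intro ω
        obtain ⟨p0, p1⟩ := hpL_bounds b ω
        have hnn : 0 ≤ l + η * (ρL - l * pL b ω) := by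
          have : l * pL b ω ≤ l := by nlinarith
          nlinarith [mul_pos hη hρL]
        have h1 := ih _ hnn
        have h2 := hstep l hl b ω
        linarith
      have hint : ∫ ω, R τ (l + η * (ρL - l * pL b ω)) ∂P ≤
          ∫ ω, ((τ * C + V l + G l * ρL + (η * (-g 0 / σ)) * K) - (G l * l) * pL b ω) ∂P :=
        integral_mono (hR_int τ b l hl) ((integrable_const _).sub ((hpi b).const_mul _)) hpt
      rw [integral_sub (integrable_const _) ((hpi b).const_mul _), integral_const_mul,
        ← hPL] at hint
      simp only [integral_const, probReal_univ, one_smul] at hint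
      have h3 := hGdual l hl b
      push_cast
      linarith
  intro T
  have h := main T 0 le_rfl
  have : - lbar * g 0 / η = - (lbar * g 0 / η) := by ring
  linarith
end
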